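/- Let M be the symmetric 6×6 matrix with unit diagonal and upper-triangular entries M₁₂ = −cos(0.20π), M₁₃ = cos(0.49π), M₁₄ = −cos(0.79π), M₁₅ = cos(0.08π), M₁₆ = −cos(0.02π), M₂₃ = −cos(0.29π), M₂₄ = cos(0.59π), M₂₅ = −cos(0.82π), M₂₆ = cos(0.22π), M₃₄ = −cos(0.30π), M₃₅ = cos(0.53π), M₃₆ = −cos(0.59π), M₄₅ = −cos(0.23π), M₄₆ = cos(0.29π), M₅₆ = −cos(0.06π). Then M is an extremal matrix of the copositive cone COP_6. -/

import Mathlib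

open Matrix Real

/-- The copositive cone. -/
def Copositive (n : ℕ) : Set (Matrix (Fin n) (Fin n) ℝ) :=
  {A | A.IsSymm ∧ ∀ x : Fin n → ℝ, (∀ i, 0 ≤ x i) → 0 ≤ x ⬝ᵥ A *ᵥ x}

/-- Extremal matrices of the copositive cone. -/
def IsExtremalCopositive (n : ℕ) (A : Matrix (Fin n) (Fin n) ℝ) : Prop :=
  A ∈ Copositive n ∧ A ≠ 0 ∧
    ∀ A₁ A₂ : Matrix (Fin n) (Fin n) ℝ, A₁ ∈ Copositive n → A₂ ∈ Copositive n →
      A = A₁ + A₂ → ∃ c₁ c₂ : ℝ, 0 ≤ c₁ ∧ 0 ≤ c₂ ∧ A₁ = c₁ • A ∧ A₂ = c₂ • A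

/-- The counterexample matrix. -/
noncomputable def Mex : Matrix (Fin 6) (Fin 6) ℝ :=
  !![1, -cos (0.20*π), cos (0.49*π), -cos (0.79*π), cos (0.08*π), -cos (0.02*π);
     -cos (0.20*π), 1, -cos (0.29*π), cos (0.59*π), -cos (0.82*π), cos (0.22*π);
     cos (0.49*π), -cos (0.29*π), 1, -cos (0.30*π), cos (0.53*π), -cos (0.59*π);
     -cos (0.79*π), cos (0.59*π), -cos (0.30*π), 1, -cos (0.23*π), cos (0.29*π);
     cos (0.08*π), -cos (0.82*π), cos (0.53*π), -cos (0.23*π), 1, -cos (0.06*π);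
     -cos (0.02*π), cos (0.22*π), -cos (0.59*π), cos (0.29*π), -cos (0.06*π), 1]

section Copositive

variable {n : ℕ} {A : Matrix (Fin n) (Fin n) ℝ}

/-- Moving `x` along a zero `u` of a symmetric quadratic form changes the form linearly. -/
lemma dotProduct_mulVec_sub_smul_zero (hA : A.IsSymm) {u : Fin n → ℝ} (hu : u ⬝ᵥ A *ᵥ u = 0)
    (x : Fin n → ℝ) (t : ℝ) :
    (x - t • u) ⬝ᵥ A *ᵥ (x - t • u) = x ⬝ᵥ A *ᵥ x - 2 * t * (x ⬝ᵥ A *ᵥ u) := by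
  have hsymm : u ⬝ᵥ A *ᵥ x = x ⬝ᵥ A *ᵥ u := by
    rw [dotProduct_mulVec, ← mulVec_transpose, hA.eq, dotProduct_comm]
  simp only [mulVec_sub, mulVec_smul, sub_dotProduct, dotProduct_sub, smul_dotProduct,
    dotProduct_smul, smul_eq_mul, hsymm, hu]
  ring

/-- A nonnegative vector can be pushed along a zero `u` with `0 ≤ A *ᵥ u` until it loses a
coordinate in the support of `u`, without increasing the quadratic form. -/
lemma exists_le_apply_eq_zero (hA : A.IsSymm) {u : Fin n → ℝ} (hu0 : ∀ i, 0 ≤ u i)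
    (hne : ∃ i, 0 < u i) (hAu : ∀ i, 0 ≤ (A *ᵥ u) i) (hu : u ⬝ᵥ A *ᵥ u = 0)
    {x : Fin n → ℝ} (hx : ∀ i, 0 ≤ x i) :
    ∃ y : Fin n → ℝ, (∀ i, 0 ≤ y i) ∧ (∀ i, y i ≤ x i) ∧
      y ⬝ᵥ A *ᵥ y ≤ x ⬝ᵥ A *ᵥ x ∧ ∃ i, 0 < u i ∧ y i = 0 := by
  classical
  obtain ⟨i₀, hi₀⟩ := hne
  obtain ⟨i, hi, hmin⟩ := Finset.exists_min_image (Finset.univ.filter fun i => 0 < u i)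
    (fun i => x i / u i) ⟨i₀, by simpa using hi₀⟩
  simp only [Finset.mem_filter, Finset.mem_univ, true_and] at hi hmin
  have ht : 0 ≤ x i / u i := div_nonneg (hx i) hi.le
  refine ⟨x - (x i / u i) • u, fun j => ?_, fun j => ?_, ?_, i, hi, ?_⟩
  · rcases (hu0 j).eq_or_lt with hj | hj
    · simpa [← hj] using hx j
    · have := (le_div_iff₀ hj).mp (hmin j hj)
      simpa using this
  · simpa using mul_nonneg ht (hu0 j)
  · rw [dotProduct_mulVec_sub_smul_zero hA hu]
    have : 0 ≤ x ⬝ᵥ A *ᵥ u := dotProduct_nonneg_of_nonneg hx hAu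
    nlinarith [mul_nonneg ht this]
  · simp [div_mul_cancel₀ _ hi.ne']

/-- A zero of a copositive form is mapped into the nonnegative orthant. -/
lemma Copositive.mulVec_nonneg (hA : A ∈ Copositive n) {u : Fin n → ℝ} (hu0 : ∀ i, 0 ≤ u i)
    (hu : u ⬝ᵥ A *ᵥ u = 0) (j : Fin n) : 0 ≤ (A *ᵥ u) j := by
  by_contra! hneg
  have key : ∀ t : ℝ, 0 ≤ t → 0 ≤ t * t * A j j + 2 * t * (A *ᵥ u) j := by
    intro t ht
    have h := hA.2 (Pi.single j t - (-1 : ℝ) • u) fun i => by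
      have : 0 ≤ (Pi.single j t : Fin n → ℝ) i := by
        by_cases hij : i = j
        · subst hij; simpa using ht
        · simp [hij]
      simpa using add_nonneg this (hu0 i)
    rw [dotProduct_mulVec_sub_smul_zero hA.1 hu] at h
    simp only [single_dotProduct, mulVec_single, Pi.smul_apply, MulOpposite.smul_eq_mul_unop,
      MulOpposite.unop_op, col_apply] at h
    linarith
  have hpos : 0 < |A j j| + 1 := by positivity
  have h := key (-(A *ᵥ u) j / (|A j j| + 1)) (div_nonneg (by linarith) hpos.le)
  set t := -(A *ᵥ u) j / (|A j j| + 1) with ht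
  have htpos : 0 < t := div_pos (by linarith) hpos
  have hmul : t * (|A j j| + 1) = -(A *ᵥ u) j := div_mul_cancel₀ _ hpos.ne'
  nlinarith [mul_pos htpos htpos, mul_pos htpos (neg_pos.mpr hneg), le_abs_self (A j j),
    mul_nonneg (mul_nonneg htpos.le htpos.le) (sub_nonneg.mpr (le_abs_self (A j j)))]

/-- Summands of a copositive matrix inherit the vanishing of `A *ᵥ u` at zeros `u`. -/
lemma Copositive.mulVec_eq_zero_of_add {A₁ A₂ : Matrix (Fin n) (Fin n) ℝ}
    (h₁ : A₁ ∈ Copositive n) (h₂ : A₂ ∈ Copositive n) {u : Fin n → ℝ} (hu0 : ∀ i, 0 ≤ u i)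
    (hu : u ⬝ᵥ (A₁ + A₂) *ᵥ u = 0) {j : Fin n} (hj : ((A₁ + A₂) *ᵥ u) j = 0) :
    (A₁ *ᵥ u) j = 0 := by
  rw [add_mulVec] at hu hj
  rw [dotProduct_add] at hu
  rw [Pi.add_apply] at hj
  have p₁ := h₁.2 u hu0
  have p₂ := h₂.2 u hu0
  have r₁ := Copositive.mulVec_nonneg h₁ hu0 (by linarith) j
  have r₂ := Copositive.mulVec_nonneg h₂ hu0 (by linarith) j
  linarith

/-- The vector with entries `a`, `b`, `c` at `i`, `j`, `k`. -/
def tripleVec (i j k : Fin n) (a b c : ℝ) : Fin n → ℝ :=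
  Pi.single i a + Pi.single j b + Pi.single k c

lemma mulVec_tripleVec (A : Matrix (Fin n) (Fin n) ℝ) (i j k l : Fin n) (a b c : ℝ) :
    (A *ᵥ tripleVec i j k a b c) l = A l i * a + A l j * b + A l k * c := by
  simp [tripleVec, mulVec_add, mulVec_single, mul_comm]

lemma tripleVec_dotProduct (i j k : Fin n) (a b c : ℝ) (x : Fin n → ℝ) :
    tripleVec i j k a b c ⬝ᵥ x = a * x i + b * x j + c * x k := by
  simp [tripleVec, add_dotProduct]

lemma single_apply_nonneg (i l : Fin n) {a : ℝ} (ha : 0 ≤ a) :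
    0 ≤ (Pi.single i a : Fin n → ℝ) l :=
  (Pi.single_nonneg.mpr ha : (0 : Fin n → ℝ) ≤ Pi.single i a) l

lemma tripleVec_nonneg (i j k : Fin n) {a b c : ℝ} (ha : 0 ≤ a) (hb : 0 ≤ b) (hc : 0 ≤ c)
    (l : Fin n) : 0 ≤ tripleVec i j k a b c l :=
  add_nonneg (add_nonneg (single_apply_nonneg i l ha) (single_apply_nonneg j l hb))
    (single_apply_nonneg k l hc)

lemma Copositive.row_eq_zero_of_add {A₁ A₂ : Matrix (Fin n) (Fin n) ℝ}
    (h₁ : A₁ ∈ Copositive n) (h₂ : A₂ ∈ Copositive n) (hA : A = A₁ + A₂)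
    {i j k l : Fin n} {a b c : ℝ} (ha : 0 ≤ a) (hb : 0 ≤ b) (hc : 0 ≤ c)
    (hi : A i i * a + A i j * b + A i k * c = 0) (hj : A j i * a + A j j * b + A j k * c = 0)
    (hk : A k i * a + A k j * b + A k k * c = 0) (hl : A l i * a + A l j * b + A l k * c = 0) :
    A₁ l i * a + A₁ l j * b + A₁ l k * c = 0 := by
  rw [← mulVec_tripleVec]
  subst hA
  refine Copositive.mulVec_eq_zero_of_add h₁ h₂ (tripleVec_nonneg i j k ha hb hc) ?_ ?_
  · rw [tripleVec_dotProduct, mulVec_tripleVec, mulVec_tripleVec, mulVec_tripleVec, hi, hj, hk]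
    ring
  · rw [mulVec_tripleVec, hl]

end Copositive

/-- A symmetric bilinear form on the plane, evaluated at unit vectors with angles `x`, `y`. -/
noncomputable def planarForm (α β γ x y : ℝ) : ℝ :=
  α * (cos x * cos y) + β * (sin x * cos y + cos x * sin y) + γ * (sin x * sin y)

lemma planarForm_one (t x y : ℝ) : planarForm t 0 t x y = t * cos (x - y) := by
  rw [planarForm, cos_sub]; ring

lemma planarForm_comm (α β γ x y : ℝ) : planarForm α β γ x y = planarForm α β γ y x := by
  unfold planarForm; ring

/-- The linear relation between three unit vectors in the plane. -/
lemma planarForm_relation (α β γ x a b c : ℝ) :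
    planarForm α β γ x a * sin (c - b) + planarForm α β γ x b * sin (a - c) +
      planarForm α β γ x c * sin (b - a) = 0 := by
  simp only [planarForm, sin_sub]; ring

lemma planarForm_diag_sub (α β γ x y : ℝ) :
    planarForm α β γ x x - planarForm α β γ y y =
      sin (x - y) * (2 * β * cos (x + y) - (α - γ) * sin (x + y)) := by
  simp only [planarForm, sin_sub, sin_add, cos_add]
  have hx := sin_sq_add_cos_sq x
  have hy := sin_sq_add_cos_sq y
  linear_combination
    (α * cos y ^ 2 + γ * sin y ^ 2 + 2 * β * sin y * cos y) * hx -
      (α * cos x ^ 2 + γ * sin x ^ 2 + 2 * β * sin x * cos x) * hy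

/-- The relation of `planarForm_relation`, squared. -/
lemma planarForm_diag_relation (α β γ a b p : ℝ) :
    sin (b - p) ^ 2 * planarForm α β γ a a +
      2 * sin (b - p) * sin (p - a) * planarForm α β γ a b +
      sin (p - a) ^ 2 * planarForm α β γ b b = sin (b - a) ^ 2 * planarForm α β γ p p := by
  have h₁ := planarForm_relation α β γ a b p a
  have h₂ := planarForm_relation α β γ b b p a
  have h₃ := planarForm_relation α β γ p b p a
  rw [planarForm_comm α β γ b a] at h₂
  rw [planarForm_comm α β γ p a, planarForm_comm α β γ p b] at h₃
  have e₁ : sin (a - p) = - sin (p - a) := by rw [← sin_neg, neg_sub]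
  have e₂ : sin (p - b) = - sin (b - p) := by rw [← sin_neg, neg_sub]
  rw [e₁, e₂] at h₁ h₂ h₃
  linear_combination -sin (b - p) * h₁ - sin (p - a) * h₂ - sin (b - a) * h₃

lemma exists_planarForm {a b : ℝ} (h : sin (b - a) ≠ 0) (x y z : ℝ) :
    ∃ α β γ : ℝ, x = planarForm α β γ a a ∧ y = planarForm α β γ a b ∧
      z = planarForm α β γ b b := by
  refine ⟨(x * sin b ^ 2 - 2 * y * (sin a * sin b) + z * sin a ^ 2) / sin (b - a) ^ 2,
    (-x * (sin b * cos b) + y * (sin b * cos a + cos b * sin a) - z * (sin a * cos a)) /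
      sin (b - a) ^ 2,
    (x * cos b ^ 2 - 2 * y * (cos a * cos b) + z * cos a ^ 2) / sin (b - a) ^ 2, ?_, ?_, ?_⟩ <;>
  · unfold planarForm
    field_simp
    rw [sin_sub]
    ring

/-- Angles of the planar unit vectors whose Gram matrix agrees with `Mex` near the diagonal. -/
noncomputable def phase : Fin 6 → ℝ :=
  ![0, 0.80 * π, 1.51 * π, 2.21 * π, 2.98 * π, 3.92 * π]

lemma Mex_isSymm : Mex.IsSymm := by
  ext i j
  fin_cases i <;> fin_cases j <;> rfl

lemma Mex_apply_self (i : Fin 6) : Mex i i = 1 := by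
  fin_cases i <;> rfl

lemma Mex_eq_cos_of_lt {i j : Fin 6} (hij : i < j) (hji : (j : ℕ) < i + 4) :
    Mex i j = cos (phase i - phase j) := by
  fin_cases i <;> fin_cases j <;> first
    | exact absurd hij (by decide)
    | exact absurd hji (by decide)
    | (simp [Mex, phase]
       try rw [← cos_pi_sub]
       refine cos_eq_cos_iff.2 ?_
       first
         | exact ⟨0, Or.inl (by push_cast; ring1)⟩
         | exact ⟨0, Or.inr (by push_cast; ring1)⟩
         | exact ⟨1, Or.inl (by push_cast; ring1)⟩
         | exact ⟨1, Or.inr (by push_cast; ring1)⟩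
         | exact ⟨-1, Or.inl (by push_cast; ring1)⟩
         | exact ⟨-1, Or.inr (by push_cast; ring1)⟩)

/-- `Mex` agrees with a Gram matrix of planar unit vectors away from the corners. -/
lemma Mex_eq_cos {i j : Fin 6} (hij : (i : ℕ) < j + 4) (hji : (j : ℕ) < i + 4) :
    Mex i j = cos (phase i - phase j) := by
  rcases lt_trichotomy i j with h | rfl | h
  · exact Mex_eq_cos_of_lt h hji
  · simp [Mex_apply_self]
  · rw [← Mex_isSymm.apply, Mex_eq_cos_of_lt h hij, ← cos_neg, neg_sub]

lemma sin_phase_sub_pos_of_succ {i j : Fin 6} (h : (j : ℕ) = i + 1) :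
    0 < sin (phase j - phase i) := by
  have := pi_pos
  apply sin_pos_of_pos_of_lt_pi <;> fin_cases i <;> fin_cases j <;> first
    | exact absurd h (by decide)
    | (simp [phase]; done)
    | (simp [phase]; linarith)

lemma sin_phase_sub_pos_of_add_two {i j : Fin 6} (h : (j : ℕ) = i + 2) :
    0 < sin (phase i - phase j) := by
  have := pi_pos
  rw [← sin_add_two_pi]
  apply sin_pos_of_pos_of_lt_pi <;> fin_cases i <;> fin_cases j <;> first
    | exact absurd h (by decide)
    | (simp [phase]; linarith)

section Summand

variable {A₁ A₂ : Matrix (Fin 6) (Fin 6) ℝ}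

lemma summand_row_consecutive (h₁ : A₁ ∈ Copositive 6) (h₂ : A₂ ∈ Copositive 6)
    (hA : Mex = A₁ + A₂) {i j k l : Fin 6} (hj : (j : ℕ) = i + 1) (hk : (k : ℕ) = i + 2)
    (hil : (l : ℕ) < i + 4) (hlk : (k : ℕ) < l + 4) :
    A₁ l i * sin (phase k - phase j) + A₁ l j * sin (phase i - phase k) +
      A₁ l k * sin (phase j - phase i) = 0 := by
  have row : ∀ m : Fin 6, (m : ℕ) < i + 4 → (k : ℕ) < m + 4 →
      Mex m i * sin (phase k - phase j) + Mex m j * sin (phase i - phase k) +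
        Mex m k * sin (phase j - phase i) = 0 := by
    intro m hm hm'
    rw [Mex_eq_cos (by omega) (by omega), Mex_eq_cos (by omega) (by omega),
      Mex_eq_cos (by omega) (by omega)]
    simpa only [planarForm_one, one_mul] using
      planarForm_relation 1 0 1 (phase m) (phase i) (phase j) (phase k)
  exact Copositive.row_eq_zero_of_add h₁ h₂ hA
    (sin_phase_sub_pos_of_succ (by omega)).le (sin_phase_sub_pos_of_add_two hk).le
    (sin_phase_sub_pos_of_succ hj).le (row i (by omega) (by omega))
    (row j (by omega) (by omega)) (row k (by omega) (by omega)) (row l hil hlk)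

/-- Away from the corners, a summand of `Mex` is a planar Gram matrix for the same vectors. -/
lemma exists_summand_eq_planarForm (h₁ : A₁ ∈ Copositive 6) (h₂ : A₂ ∈ Copositive 6)
    (hA : Mex = A₁ + A₂) :
    ∃ α β γ : ℝ, ∀ i j : Fin 6, (i : ℕ) < j + 4 → (j : ℕ) < i + 4 →
      A₁ i j = planarForm α β γ (phase i) (phase j) := by
  obtain ⟨α, β, γ, h22, h23, h33⟩ := exists_planarForm
    (sin_phase_sub_pos_of_succ (i := 2) (j := 3) rfl).ne' (A₁ 2 2) (A₁ 2 3) (A₁ 3 3)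
  refine ⟨α, β, γ, ?_⟩
  let P : Fin 6 → Fin 6 → Prop := fun i j => A₁ i j = planarForm α β γ (phase i) (phase j)
  have symm : ∀ {i j}, P i j → P j i := by
    intro i j h
    change A₁ j i = _
    rw [planarForm_comm, ← h]
    exact h₁.1.apply i j
  have back : ∀ {i j k : Fin 6} (l : Fin 6), (j : ℕ) = i + 1 → (k : ℕ) = i + 2 → (l : ℕ) < i + 4 →
      (k : ℕ) < l + 4 → P l j → P l k → P l i := by
    intro i j k l hj hk hil hlk hPj hPk
    have e := summand_row_consecutive h₁ h₂ hA hj hk hil hlk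
    have e' := planarForm_relation α β γ (phase l) (phase i) (phase j) (phase k)
    rw [show A₁ l j = _ from hPj, show A₁ l k = _ from hPk] at e
    exact mul_right_cancel₀ (sin_phase_sub_pos_of_succ (i := j) (j := k) (by omega)).ne'
      (by linarith)
  have forth : ∀ {i j k : Fin 6} (l : Fin 6), (j : ℕ) = i + 1 → (k : ℕ) = i + 2 → (l : ℕ) < i + 4 →
      (k : ℕ) < l + 4 → P l i → P l j → P l k := by
    intro i j k l hj hk hil hlk hPi hPj
    have e := summand_row_consecutive h₁ h₂ hA hj hk hil hlk
    have e' := planarForm_relation α β γ (phase l) (phase i) (phase j) (phase k)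
    rw [show A₁ l i = _ from hPi, show A₁ l j = _ from hPj] at e
    exact mul_right_cancel₀ (sin_phase_sub_pos_of_succ hj).ne' (by linarith)
  have p22 : P 2 2 := h22
  have p23 : P 2 3 := h23
  have p33 : P 3 3 := h33
  have p32 := symm p23
  have p21 : P 2 1 := back (k := 3) 2 rfl rfl (by decide) (by decide) p22 p23
  have p20 : P 2 0 := back (k := 2) 2 rfl rfl (by decide) (by decide) p21 p22
  have p24 : P 2 4 := forth (i := 2) 2 rfl rfl (by decide) (by decide) p22 p23
  have p25 : P 2 5 := forth (i := 3) 2 rfl rfl (by decide) (by decide) p23 p24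
  have p31 : P 3 1 := back (k := 3) 3 rfl rfl (by decide) (by decide) p32 p33
  have p30 : P 3 0 := back (k := 2) 3 rfl rfl (by decide) (by decide) p31 p32
  have p34 : P 3 4 := forth (i := 2) 3 rfl rfl (by decide) (by decide) p32 p33
  have p35 : P 3 5 := forth (i := 3) 3 rfl rfl (by decide) (by decide) p33 p34
  have p11 : P 1 1 := back (k := 3) 1 rfl rfl (by decide) (by decide) (symm p21) (symm p31)
  have p10 : P 1 0 := back (k := 2) 1 rfl rfl (by decide) (by decide) p11 (symm p21)
  have p14 : P 1 4 := forth (i := 2) 1 rfl rfl (by decide) (by decide) (symm p21) (symm p31)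
  have p00 : P 0 0 := back (k := 2) 0 rfl rfl (by decide) (by decide) (symm p10) (symm p20)
  have p44 : P 4 4 := forth (i := 2) 4 rfl rfl (by decide) (by decide) (symm p24) (symm p34)
  have p45 : P 4 5 := forth (i := 3) 4 rfl rfl (by decide) (by decide) (symm p34) p44
  have p55 : P 5 5 := forth (i := 3) 5 rfl rfl (by decide) (by decide) (symm p35) (symm p45)
  intro i j hij hji
  change P i j
  fin_cases i <;> fin_cases j <;> first
    | assumption
    | (apply symm; assumption)
    | exact absurd hij (by decide)
    | exact absurd hji (by decide)

end Summand

lemma cos_sub_relation (x a b p : ℝ) :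
    sin (b - p) * cos (x - a) + sin (p - a) * cos (x - b) = sin (b - a) * cos (x - p) := by
  simp only [sin_sub, cos_sub]
  ring

lemma Mex_row_of_band {i j k l : Fin 6} {p : ℝ} (hli : (l : ℕ) < i + 4)
    (hil : (i : ℕ) < l + 4) (hlj : (l : ℕ) < j + 4) (hjl : (j : ℕ) < l + 4) :
    Mex l i * sin (phase j - p) + Mex l j * sin (p - phase i) +
      Mex l k * sin (phase j - phase i) =
      (cos (phase l - p) + Mex l k) * sin (phase j - phase i) := by
  rw [Mex_eq_cos hli hil, Mex_eq_cos hlj hjl]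
  linear_combination cos_sub_relation (phase l) (phase i) (phase j) p

/-- A zero of `Mex` on `{i, j, k}`, where the `k`-th vector behaves like the negative of the
planar unit vector with angle `p`. -/
structure IsCornerZero (i j k : Fin 6) (p : ℝ) : Prop where
  lt₁ : (i : ℕ) < j + 4
  lt₂ : (j : ℕ) < i + 4
  left_pos : 0 < sin (phase j - p)
  mid_pos : 0 < sin (p - phase i)
  right_pos : 0 < sin (phase j - phase i)
  left_eq : Mex i k = -cos (p - phase i)
  right_eq : Mex j k = -cos (p - phase j)

namespace IsCornerZero

variable {i j k : Fin 6} {p : ℝ}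

lemma row_left (h : IsCornerZero i j k p) :
    Mex i i * sin (phase j - p) + Mex i j * sin (p - phase i) +
      Mex i k * sin (phase j - phase i) = 0 := by
  have e := cos_sub_relation (phase i) (phase i) (phase j) p
  rw [Mex_eq_cos (i := i) (j := i) (by omega) (by omega), Mex_eq_cos h.lt₁ h.lt₂, h.left_eq,
    ← cos_neg (p - phase i), neg_sub]
  linarith

lemma row_mid (h : IsCornerZero i j k p) :
    Mex j i * sin (phase j - p) + Mex j j * sin (p - phase i) +
      Mex j k * sin (phase j - phase i) = 0 := by
  have e := cos_sub_relation (phase j) (phase i) (phase j) p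
  rw [Mex_eq_cos (i := j) (j := j) (by omega) (by omega), Mex_eq_cos h.lt₂ h.lt₁, h.right_eq,
    ← cos_neg (p - phase j), neg_sub]
  linarith

lemma row_right (h : IsCornerZero i j k p) :
    Mex k i * sin (phase j - p) + Mex k j * sin (p - phase i) +
      Mex k k * sin (phase j - phase i) = 0 := by
  have e := cos_sub_relation p (phase i) (phase j) p
  rw [Mex_apply_self, ← Mex_isSymm.apply k i, ← Mex_isSymm.apply k j, h.left_eq, h.right_eq]
  rw [sub_self, cos_zero] at e
  linarith

lemma summand_row {A₁ A₂ : Matrix (Fin 6) (Fin 6) ℝ} (h : IsCornerZero i j k p)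
    (h₁ : A₁ ∈ Copositive 6) (h₂ : A₂ ∈ Copositive 6) (hA : Mex = A₁ + A₂) {l : Fin 6}
    (hl : l = i ∨ l = j ∨ l = k) :
    A₁ l i * sin (phase j - p) + A₁ l j * sin (p - phase i) +
      A₁ l k * sin (phase j - phase i) = 0 := by
  refine Copositive.row_eq_zero_of_add h₁ h₂ hA h.left_pos.le h.mid_pos.le h.right_pos.le
    h.row_left h.row_mid h.row_right ?_
  rcases hl with rfl | rfl | rfl
  exacts [h.row_left, h.row_mid, h.row_right]

lemma summand_diag {A₁ A₂ : Matrix (Fin 6) (Fin 6) ℝ} (h : IsCornerZero i j k p)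
    (h₁ : A₁ ∈ Copositive 6) (h₂ : A₂ ∈ Copositive 6) (hA : Mex = A₁ + A₂) {α β γ : ℝ}
    (hii : A₁ i i = planarForm α β γ (phase i) (phase i))
    (hij : A₁ i j = planarForm α β γ (phase i) (phase j))
    (hjj : A₁ j j = planarForm α β γ (phase j) (phase j)) :
    A₁ k k = planarForm α β γ p p := by
  have ei := h.summand_row h₁ h₂ hA (l := i) (by simp)
  have ej := h.summand_row h₁ h₂ hA (l := j) (by simp)
  have ek := h.summand_row h₁ h₂ hA (l := k) (by simp)
  have e := planarForm_diag_relation α β γ (phase i) (phase j) p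
  rw [← h₁.1.apply j i] at ej
  rw [← h₁.1.apply k i, ← h₁.1.apply k j] at ek
  rw [← hii, ← hij, ← hjj] at e
  refine mul_left_cancel₀ (pow_ne_zero 2 h.right_pos.ne') ?_
  linear_combination e - sin (phase j - p) * ei - sin (p - phase i) * ej +
    sin (phase j - phase i) * ek

lemma exists_le_apply_eq_zero (h : IsCornerZero i j k p)
    (hrow : ∀ l, 0 ≤ Mex l i * sin (phase j - p) + Mex l j * sin (p - phase i) +
      Mex l k * sin (phase j - phase i)) {x : Fin 6 → ℝ} (hx : ∀ l, 0 ≤ x l) :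
    ∃ y : Fin 6 → ℝ, (∀ l, 0 ≤ y l) ∧ (∀ l, y l ≤ x l) ∧
      y ⬝ᵥ Mex *ᵥ y ≤ x ⬝ᵥ Mex *ᵥ x ∧ (y i = 0 ∨ y j = 0 ∨ y k = 0) := by
  set u := tripleVec i j k (sin (phase j - p)) (sin (p - phase i)) (sin (phase j - phase i))
    with hu
  have hpos : 0 < u k := by
    have hi := single_apply_nonneg i k h.left_pos.le
    have hj := single_apply_nonneg j k h.mid_pos.le
    have hk := h.right_pos
    simp only [hu, tripleVec, Pi.add_apply, Pi.single_eq_same]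
    linarith
  obtain ⟨y, hy0, hyx, hyq, l, hl, hyl⟩ := _root_.exists_le_apply_eq_zero Mex_isSymm
    (tripleVec_nonneg i j k h.left_pos.le h.mid_pos.le h.right_pos.le) ⟨k, hpos⟩
    (fun l => by rw [mulVec_tripleVec]; exact hrow l)
    (by
      rw [tripleVec_dotProduct, mulVec_tripleVec, mulVec_tripleVec, mulVec_tripleVec,
        h.row_left, h.row_mid, h.row_right]
      ring) hx
  refine ⟨y, hy0, hyx, hyq, ?_⟩
  by_contra! hne
  have hli : l ≠ i := by rintro rfl; exact hne.1 hyl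
  have hlj : l ≠ j := by rintro rfl; exact hne.2.1 hyl
  have hlk : l ≠ k := by rintro rfl; exact hne.2.2 hyl
  simp [tripleVec, hli, hlj, hlk] at hl

/-- If a summand is proportional to `Mex` on the `{i, j}` block, it also is on `{i, j, k}`. -/
lemma summand_corner {A₁ A₂ : Matrix (Fin 6) (Fin 6) ℝ} (h : IsCornerZero i j k p)
    (h₁ : A₁ ∈ Copositive 6) (h₂ : A₂ ∈ Copositive 6) (hA : Mex = A₁ + A₂) {α : ℝ}
    (hii : A₁ i i = α * Mex i i) (hij : A₁ i j = α * Mex i j) (hjj : A₁ j j = α * Mex j j) :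
    A₁ i k = α * Mex i k ∧ A₁ j k = α * Mex j k := by
  have ei := h.summand_row h₁ h₂ hA (l := i) (by simp)
  have ej := h.summand_row h₁ h₂ hA (l := j) (by simp)
  have hji : A₁ j i = α * Mex j i := by rw [← h₁.1.apply, ← Mex_isSymm.apply, hij]
  rw [hii, hij] at ei
  rw [hji, hjj] at ej
  constructor <;> refine mul_right_cancel₀ h.right_pos.ne' ?_
  · linear_combination ei - α * h.row_left
  · linear_combination ej - α * h.row_mid

end IsCornerZero

lemma isCornerZero_zero_one_five : IsCornerZero 0 1 5 (0.02 * π) := by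
  have := pi_pos
  refine ⟨by decide, by decide, ?_, ?_, ?_, ?_, ?_⟩
  · apply sin_pos_of_pos_of_lt_pi <;> simp [phase] <;> linarith
  · apply sin_pos_of_pos_of_lt_pi <;> simp [phase] <;> linarith
  · apply sin_pos_of_pos_of_lt_pi <;> simp [phase] <;> linarith
  · simp [Mex, phase]
  · simp only [Mex, phase]
    simp
    rw [← cos_pi_sub]
    refine cos_eq_cos_iff.2 ⟨1, Or.inr ?_⟩
    push_cast
    ring

lemma isCornerZero_four_five_zero : IsCornerZero 4 5 0 (3.90 * π) := by
  have := pi_pos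
  refine ⟨by decide, by decide, ?_, ?_, ?_, ?_, ?_⟩
  · apply sin_pos_of_pos_of_lt_pi <;> simp [phase] <;> linarith
  · apply sin_pos_of_pos_of_lt_pi <;> simp [phase] <;> linarith
  · apply sin_pos_of_pos_of_lt_pi <;> simp [phase] <;> linarith
  · simp only [Mex, phase]
    simp
    rw [← cos_pi_sub]
    refine cos_eq_cos_iff.2 ⟨0, Or.inl ?_⟩
    push_cast
    ring
  · simp only [Mex, phase]
    simp
    refine cos_eq_cos_iff.2 ⟨0, Or.inr ?_⟩
    push_cast
    ring

lemma cos_mul_pi_nonneg {r : ℝ} (h₀ : 0 ≤ r) (h₁ : r ≤ 1 / 2) : 0 ≤ cos (r * π) := by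
  have := pi_pos
  exact cos_nonneg_of_mem_Icc ⟨by nlinarith, by nlinarith⟩

lemma cos_mul_pi_nonpos {r : ℝ} (h₀ : 1 / 2 ≤ r) (h₁ : r ≤ 1) : cos (r * π) ≤ 0 := by
  have := pi_pos
  exact cos_nonpos_of_pi_div_two_le_of_le (by nlinarith) (by nlinarith)

lemma sin_mul_pi_nonneg {r : ℝ} (h₀ : 0 ≤ r) (h₁ : r ≤ 1) : 0 ≤ sin (r * π) := by
  have := pi_pos
  exact sin_nonneg_of_mem_Icc ⟨by nlinarith, by nlinarith⟩

lemma cos_mul_pi_anti {r s : ℝ} (h₀ : 0 ≤ r) (h : r ≤ s) (h₁ : s ≤ 1) :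
    cos (s * π) ≤ cos (r * π) := by
  have := pi_pos
  exact cos_le_cos_of_nonneg_of_le_pi (by nlinarith) (by nlinarith) (by nlinarith)

lemma cos_mul_pi_eq_of_sub {r s : ℝ} (h : r - s = 2) : cos (r * π) = cos (s * π) := by
  rw [← cos_add_two_pi (s * π)]
  congr 1
  linear_combination π * h

lemma cos_mul_pi_eq_of_add {r s : ℝ} (h : r + s = 2) : cos (r * π) = cos (s * π) := by
  rw [← cos_two_pi_sub (s * π)]
  congr 1
  linear_combination π * h

lemma sin_mul_pi_anti {r s : ℝ} (h₀ : 1 / 2 ≤ r) (h : r ≤ s) (h₁ : s ≤ 1) :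
    sin (s * π) ≤ sin (r * π) := by
  have key : ∀ t : ℝ, sin (t * π) = cos ((t - 1 / 2) * π) := by
    intro t
    rw [← cos_sub_pi_div_two]
    congr 1
    ring
  rw [key, key]
  exact cos_mul_pi_anti (by linarith) (by linarith) (by linarith)

lemma row_nonneg_zero_one_five (l : Fin 6) :
    0 ≤ Mex l 0 * sin (phase 1 - 0.02 * π) + Mex l 1 * sin (0.02 * π - phase 0) +
      Mex l 5 * sin (phase 1 - phase 0) := by
  have h := isCornerZero_zero_one_five
  fin_cases l
  · exact h.row_left.ge
  · exact h.row_mid.ge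
  · change 0 ≤ Mex 2 0 * _ + Mex 2 1 * _ + Mex 2 5 * _
    rw [Mex_row_of_band (by decide) (by decide) (by decide) (by decide)]
    refine mul_nonneg ?_ h.right_pos.le
    change 0 ≤ cos (1.51 * π - 0.02 * π) + -cos (0.59 * π)
    rw [← sub_mul, cos_mul_pi_eq_of_add (s := 0.51) (by norm_num)]
    linarith [cos_mul_pi_anti (r := 0.51) (s := 0.59) (by norm_num) (by norm_num) (by norm_num)]
  · change 0 ≤ Mex 3 0 * _ + Mex 3 1 * _ + Mex 3 5 * _
    rw [Mex_row_of_band (by decide) (by decide) (by decide) (by decide)]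
    refine mul_nonneg ?_ h.right_pos.le
    change 0 ≤ cos (2.21 * π - 0.02 * π) + cos (0.29 * π)
    rw [← sub_mul, cos_mul_pi_eq_of_sub (s := 0.19) (by norm_num)]
    exact add_nonneg (cos_mul_pi_nonneg (by norm_num) (by norm_num))
      (cos_mul_pi_nonneg (by norm_num) (by norm_num))
  · change 0 ≤ cos (0.08 * π) * sin (0.80 * π - 0.02 * π) +
      -cos (0.82 * π) * sin (0.02 * π - 0) + -cos (0.06 * π) * sin (0.80 * π - 0)
    rw [sub_zero, sub_zero]
    have e₁ := sin_add (0.80 * π - 0.02 * π) (0.08 * π)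
    have e₂ := sin_sub (0.80 * π - 0.02 * π) (0.08 * π)
    have e₃ := sin_add (0.80 * π) (0.06 * π)
    have e₄ := sin_sub (0.80 * π) (0.06 * π)
    rw [show 0.80 * π - 0.02 * π + 0.08 * π = 0.86 * π by ring] at e₁
    rw [show 0.80 * π - 0.02 * π - 0.08 * π = 0.70 * π by ring] at e₂
    rw [show 0.80 * π + 0.06 * π = 0.86 * π by ring] at e₃
    rw [show 0.80 * π - 0.06 * π = 0.74 * π by ring] at e₄
    have anti := sin_mul_pi_anti (r := 0.70) (s := 0.74) (by norm_num) (by norm_num) (by norm_num)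
    have hmul := mul_nonneg
      (neg_nonneg.mpr (cos_mul_pi_nonpos (r := 0.82) (by norm_num) (by norm_num)))
      (sin_mul_pi_nonneg (r := 0.02) (by norm_num) (by norm_num))
    linarith
  · exact h.row_right.ge

lemma row_nonneg_four_five_zero (l : Fin 6) :
    0 ≤ Mex l 4 * sin (phase 5 - 3.90 * π) + Mex l 5 * sin (3.90 * π - phase 4) +
      Mex l 0 * sin (phase 5 - phase 4) := by
  have h := isCornerZero_four_five_zero
  fin_cases l
  · exact h.row_right.ge
  · change 0 ≤ -cos (0.82 * π) * sin (3.92 * π - 3.90 * π) +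
      cos (0.22 * π) * sin (3.90 * π - 2.98 * π) + -cos (0.20 * π) * sin (3.92 * π - 2.98 * π)
    rw [← sub_mul, ← sub_mul, ← sub_mul]
    have e₁ := sin_add ((3.90 - 2.98) * π) (0.22 * π)
    have e₂ := sin_sub ((3.90 - 2.98) * π) (0.22 * π)
    have e₃ := sin_add ((3.92 - 2.98) * π) (0.20 * π)
    have e₄ := sin_sub ((3.92 - 2.98) * π) (0.20 * π)
    rw [show (3.90 - 2.98) * π + 0.22 * π = 1.14 * π by ring] at e₁
    rw [show (3.90 - 2.98) * π - 0.22 * π = 0.70 * π by ring] at e₂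
    rw [show (3.92 - 2.98) * π + 0.20 * π = 1.14 * π by ring] at e₃
    rw [show (3.92 - 2.98) * π - 0.20 * π = 0.74 * π by ring] at e₄
    have anti := sin_mul_pi_anti (r := 0.70) (s := 0.74) (by norm_num) (by norm_num) (by norm_num)
    have hmul := mul_nonneg
      (neg_nonneg.mpr (cos_mul_pi_nonpos (r := 0.82) (by norm_num) (by norm_num)))
      (sin_mul_pi_nonneg (r := 3.92 - 3.90) (by norm_num) (by norm_num))
    linarith
  · change 0 ≤ Mex 2 4 * _ + Mex 2 5 * _ + Mex 2 0 * _
    rw [Mex_row_of_band (by decide) (by decide) (by decide) (by decide)]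
    refine mul_nonneg ?_ h.right_pos.le
    change 0 ≤ cos (1.51 * π - 3.90 * π) + cos (0.49 * π)
    rw [← cos_neg (_ - _), neg_sub, ← sub_mul, cos_mul_pi_eq_of_sub (s := 0.39) (by norm_num)]
    exact add_nonneg (cos_mul_pi_nonneg (by norm_num) (by norm_num))
      (cos_mul_pi_nonneg (by norm_num) (by norm_num))
  · change 0 ≤ Mex 3 4 * _ + Mex 3 5 * _ + Mex 3 0 * _
    rw [Mex_row_of_band (by decide) (by decide) (by decide) (by decide)]
    refine mul_nonneg ?_ h.right_pos.le
    change 0 ≤ cos (2.21 * π - 3.90 * π) + -cos (0.79 * π)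
    rw [← cos_neg (_ - _), neg_sub, ← sub_mul, cos_mul_pi_eq_of_add (s := 0.31) (by norm_num)]
    exact add_nonneg (cos_mul_pi_nonneg (by norm_num) (by norm_num))
      (neg_nonneg.mpr (cos_mul_pi_nonpos (by norm_num) (by norm_num)))
  · exact h.row_left.ge
  · exact h.row_mid.ge

lemma dotProduct_mulVec_eq_sum {n : ℕ} (A : Matrix (Fin n) (Fin n) ℝ) (x : Fin n → ℝ) :
    x ⬝ᵥ A *ᵥ x = ∑ i, ∑ j, x i * x j * A i j := by
  simp only [dotProduct, mulVec, Finset.mul_sum]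
  exact Finset.sum_congr rfl fun i _ => Finset.sum_congr rfl fun j _ => by ring

lemma sum_cos_sub_nonneg {n : ℕ} (φ x : Fin n → ℝ) :
    0 ≤ ∑ i, ∑ j, x i * x j * cos (φ i - φ j) := by
  have : ∑ i, ∑ j, x i * x j * cos (φ i - φ j) =
      (∑ i, x i * cos (φ i)) ^ 2 + (∑ i, x i * sin (φ i)) ^ 2 := by
    simp only [sq, Finset.sum_mul_sum, ← Finset.sum_add_distrib]
    refine Finset.sum_congr rfl fun i _ => Finset.sum_congr rfl fun j _ => ?_
    rw [cos_sub]
    ring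
  rw [this]
  positivity

lemma Mex_form_nonneg_of_corner {x : Fin 6 → ℝ} (hx : ∀ i, 0 ≤ x i) (h : x 0 * x 5 = 0) :
    0 ≤ x ⬝ᵥ Mex *ᵥ x := by
  have h04 : cos (phase 0 - phase 4) ≤ Mex 0 4 := by
    change cos (0 - 2.98 * π) ≤ cos (0.08 * π)
    rw [zero_sub, cos_neg, cos_mul_pi_eq_of_sub (s := 0.98) (by norm_num)]
    exact cos_mul_pi_anti (by norm_num) (by norm_num) (by norm_num)
  have h15 : cos (phase 1 - phase 5) ≤ Mex 1 5 := by
    change cos (0.80 * π - 3.92 * π) ≤ cos (0.22 * π)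
    rw [← cos_neg (_ - _), neg_sub, ← sub_mul, cos_mul_pi_eq_of_sub (s := 1.12) (by norm_num),
      cos_mul_pi_eq_of_add (s := 0.88) (by norm_num)]
    exact cos_mul_pi_anti (by norm_num) (by norm_num) (by norm_num)
  have cos_symm : ∀ i j, cos (phase i - phase j) = cos (phase j - phase i) := by
    intro i j
    rw [← cos_neg, neg_sub]
  rw [dotProduct_mulVec_eq_sum]
  refine (sum_cos_sub_nonneg phase x).trans
    (Finset.sum_le_sum fun i _ => Finset.sum_le_sum fun j _ => ?_)
  have upper : ∀ i j : Fin 6, i ≤ j →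
      x i * x j * cos (phase i - phase j) ≤ x i * x j * Mex i j := by
    intro i j hij
    by_cases hji : (j : ℕ) < i + 4
    · rw [Mex_eq_cos (by omega) hji]
    · have hcases : (i = 0 ∧ j = 4) ∨ (i = 0 ∧ j = 5) ∨ (i = 1 ∧ j = 5) := by omega
      rcases hcases with ⟨rfl, rfl⟩ | ⟨rfl, rfl⟩ | ⟨rfl, rfl⟩
      · exact mul_le_mul_of_nonneg_left h04 (mul_nonneg (hx _) (hx _))
      · simp [h]
      · exact mul_le_mul_of_nonneg_left h15 (mul_nonneg (hx _) (hx _))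
  rcases le_total i j with hij | hji
  · exact upper i j hij
  · rw [cos_symm, ← Mex_isSymm.apply i j, mul_comm (x i)]
    exact upper j i hji

lemma Mex_form_nonneg_of_inner {x : Fin 6 → ℝ} (hx : ∀ i, 0 ≤ x i) (h1 : x 1 = 0)
    (h4 : x 4 = 0) : 0 ≤ x ⬝ᵥ Mex *ᵥ x := by
  have h02 : 0 ≤ Mex 0 2 := cos_mul_pi_nonneg (by norm_num) (by norm_num)
  have h03 : 0 ≤ Mex 0 3 := neg_nonneg.mpr (cos_mul_pi_nonpos (by norm_num) (by norm_num))
  have h05 : -1 ≤ Mex 0 5 := neg_le_neg (cos_le_one _)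
  have h23 : -1 ≤ Mex 2 3 := neg_le_neg (cos_le_one _)
  have h25 : 0 ≤ Mex 2 5 := neg_nonneg.mpr (cos_mul_pi_nonpos (by norm_num) (by norm_num))
  have h35 : 0 ≤ Mex 3 5 := cos_mul_pi_nonneg (by norm_num) (by norm_num)
  have prod : ∀ i j, 0 ≤ x i * x j := fun i j => mul_nonneg (hx i) (hx j)
  rw [dotProduct_mulVec_eq_sum]
  simp only [Fin.sum_univ_six, Mex_apply_self, h1, h4, ← Mex_isSymm.apply 2 0,
    ← Mex_isSymm.apply 3 0, ← Mex_isSymm.apply 5 0, ← Mex_isSymm.apply 3 2,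
    ← Mex_isSymm.apply 5 2, ← Mex_isSymm.apply 5 3]
  linarith [mul_nonneg (prod 0 2) h02, mul_nonneg (prod 0 3) h03, mul_nonneg (prod 2 5) h25,
    mul_nonneg (prod 3 5) h35, mul_le_mul_of_nonneg_left h05 (prod 0 5),
    mul_le_mul_of_nonneg_left h23 (prod 2 3), sq_nonneg (x 0 - x 5), sq_nonneg (x 2 - x 3)]

lemma Mex_mem_copositive : Mex ∈ Copositive 6 := by
  refine ⟨Mex_isSymm, fun x hx => ?_⟩
  obtain ⟨y, hy0, -, hyq, hy⟩ := isCornerZero_zero_one_five.exists_le_apply_eq_zero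
    row_nonneg_zero_one_five hx
  refine le_trans ?_ hyq
  rcases hy with hy | hy | hy
  · exact Mex_form_nonneg_of_corner hy0 (by simp [hy])
  · obtain ⟨z, hz0, hzy, hzq, hz⟩ := isCornerZero_four_five_zero.exists_le_apply_eq_zero
      row_nonneg_four_five_zero hy0
    refine le_trans ?_ hzq
    rcases hz with hz | hz | hz
    · exact Mex_form_nonneg_of_inner hz0 (le_antisymm (hy ▸ hzy 1) (hz0 1)) hz
    · exact Mex_form_nonneg_of_corner hz0 (by simp [hz])
    · exact Mex_form_nonneg_of_corner hz0 (by simp [hz])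
  · exact Mex_form_nonneg_of_corner hy0 (by simp [hy])

lemma Copositive.diag_nonneg {n : ℕ} {A : Matrix (Fin n) (Fin n) ℝ} (hA : A ∈ Copositive n)
    (i : Fin n) : 0 ≤ A i i := by
  have h := hA.2 (Pi.single i 1) fun j => single_apply_nonneg i j zero_le_one
  simpa [mulVec_single] using h

lemma eq_zero_of_mul_cos_eq_mul_sin {a b s t : ℝ} (hs : a * cos s = b * sin s)
    (ht : a * cos t = b * sin t) (h : sin (s - t) ≠ 0) : a = 0 ∧ b = 0 := by
  constructor <;> refine mul_right_cancel₀ h ?_ <;> rw [sin_sub]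
  · linear_combination sin s * ht - sin t * hs
  · linear_combination cos s * ht - cos t * hs

lemma summand_eq_smul {A₁ A₂ : Matrix (Fin 6) (Fin 6) ℝ} (h₁ : A₁ ∈ Copositive 6)
    (h₂ : A₂ ∈ Copositive 6) (hA : Mex = A₁ + A₂) : ∃ c : ℝ, A₁ = c • Mex := by
  obtain ⟨α, β, γ, hK⟩ := exists_summand_eq_planarForm h₁ h₂ hA
  have z := isCornerZero_zero_one_five
  have w := isCornerZero_four_five_zero
  have e₁ := planarForm_diag_sub α β γ (0.02 * π) (phase 5)
  rw [← z.summand_diag h₁ h₂ hA (hK _ _ (by decide) (by decide)) (hK _ _ (by decide) (by decide))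
    (hK _ _ (by decide) (by decide)), hK 5 5 (by decide) (by decide), sub_self] at e₁
  have e₂ := planarForm_diag_sub α β γ (3.90 * π) (phase 0)
  rw [← w.summand_diag h₁ h₂ hA (hK _ _ (by decide) (by decide)) (hK _ _ (by decide) (by decide))
    (hK _ _ (by decide) (by decide)), hK 0 0 (by decide) (by decide), sub_self] at e₂
  have hpi := pi_pos
  have s₁ : sin (0.02 * π - phase 5) ≠ 0 := by
    change sin (0.02 * π - 3.92 * π) ≠ 0
    rw [← sin_add_two_pi, ← sin_add_two_pi]
    exact (sin_pos_of_pos_of_lt_pi (by linarith) (by linarith)).ne'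
  have s₂ : sin (3.90 * π - phase 0) ≠ 0 := by
    change sin (3.90 * π - 0) ≠ 0
    rw [← sin_sub_two_pi]
    exact (sin_neg_of_neg_of_neg_pi_lt (x := 3.90 * π - 0 - 2 * π - 2 * π)
      (by linarith) (by linarith)).ne ∘ fun h => by rw [sin_sub_two_pi, h]
  have s₃ : sin (0.02 * π + phase 5 - (3.90 * π + phase 0)) ≠ 0 := by
    change sin (0.02 * π + 3.92 * π - (3.90 * π + 0)) ≠ 0
    exact (sin_pos_of_pos_of_lt_pi (by linarith) (by linarith)).ne'
  obtain ⟨hβ, hαγ⟩ := eq_zero_of_mul_cos_eq_mul_sin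
    (sub_eq_zero.mp ((mul_eq_zero.mp e₁.symm).resolve_left s₁))
    (sub_eq_zero.mp ((mul_eq_zero.mp e₂.symm).resolve_left s₂)) s₃
  obtain rfl : β = 0 := by linarith
  obtain rfl : γ = α := by linarith
  have hband : ∀ i j : Fin 6, (i : ℕ) < j + 4 → (j : ℕ) < i + 4 → A₁ i j = γ * Mex i j := by
    intro i j hij hji
    rw [hK i j hij hji, planarForm_one, Mex_eq_cos hij hji]
  obtain ⟨h05, h15⟩ := z.summand_corner h₁ h₂ hA (hband _ _ (by decide) (by decide))
    (hband _ _ (by decide) (by decide)) (hband _ _ (by decide) (by decide))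
  obtain ⟨h40, -⟩ := w.summand_corner h₁ h₂ hA (hband _ _ (by decide) (by decide))
    (hband _ _ (by decide) (by decide)) (hband _ _ (by decide) (by decide))
  have symm : ∀ {i j}, A₁ i j = γ * Mex i j → A₁ j i = γ * Mex j i := by
    intro i j h
    rw [← h₁.1.apply, ← Mex_isSymm.apply, h]
  refine ⟨γ, ?_⟩
  ext i j
  rw [Matrix.smul_apply, smul_eq_mul]
  by_cases hij : (i : ℕ) < j + 4 ∧ (j : ℕ) < i + 4
  · exact hband i j hij.1 hij.2
  · have hcases : (i = 0 ∧ j = 4) ∨ (i = 0 ∧ j = 5) ∨ (i = 1 ∧ j = 5) ∨ (i = 4 ∧ j = 0) ∨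
        (i = 5 ∧ j = 0) ∨ (i = 5 ∧ j = 1) := by omega
    rcases hcases with ⟨rfl, rfl⟩ | ⟨rfl, rfl⟩ | ⟨rfl, rfl⟩ | ⟨rfl, rfl⟩ | ⟨rfl, rfl⟩ | ⟨rfl, rfl⟩
    exacts [symm h40, h05, h15, h40, symm h05, symm h15]

theorem Mex_extremal : IsExtremalCopositive 6 Mex := by
  refine ⟨Mex_mem_copositive, fun h => ?_, fun A₁ A₂ h₁ h₂ hA => ?_⟩
  · have h00 := Mex_apply_self 0
    simp [h] at h00
  · obtain ⟨c₁, hc₁⟩ := summand_eq_smul h₁ h₂ hA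
    obtain ⟨c₂, hc₂⟩ := summand_eq_smul h₂ h₁ (hA.trans (add_comm _ _))
    have d₁ := Copositive.diag_nonneg h₁ 0
    have d₂ := Copositive.diag_nonneg h₂ 0
    rw [hc₁, Matrix.smul_apply, Mex_apply_self, smul_eq_mul, mul_one] at d₁
    rw [hc₂, Matrix.smul_apply, Mex_apply_self, smul_eq_mul, mul_one] at d₂
    exact ⟨c₁, c₂, d₁, d₂, hc₁, hc₂⟩
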